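/- There exists a compact set A in ℝ³ with nonempty interior such that the interior of A is connected but not simply connected (i.e., A has a hole), and A is an 8-rep-tile: there exist isometries h₁, …, h₈ of ℝ³ such that the scaled set 2•A equals the union h₁(A) ∪ … ∪ h₈(A), and the interiors of the sets h₁(A), …, h₈(A) are pairwise disjoint. -/

import Mathlib

open Pointwise

open Real (ofDigits)
open Set

namespace RepTile

/-- Three-dimensional Euclidean space. -/
abbrev E3 : Type := EuclideanSpace ℝ (Fin 3)

/-! ### Binary expansions -/

theorem two_mul_ofDigits (a : ℕ → Fin 2) :
    2 * ofDigits a = (a 0 : ℕ) + ofDigits fun n => a (n + 1) := by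
  rw [Real.ofDigits_eq_sum_add_ofDigits a 1]
  simp [Real.ofDigitsTerm]
  ring

theorem ofDigits_mul_le_left (a b : ℕ → Fin 2) : ofDigits (a * b) ≤ ofDigits a := by
  refine Summable.tsum_mono Real.summable_ofDigitsTerm Real.summable_ofDigitsTerm fun n => ?_
  have h : ∀ i j : Fin 2, ((i * j : Fin 2) : ℕ) ≤ i := by decide
  simp only [Real.ofDigitsTerm, Pi.mul_apply]
  gcongr
  exact h _ _

theorem ofDigits_mul_le_right (a b : ℕ → Fin 2) : ofDigits (a * b) ≤ ofDigits b := by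
  rw [mul_comm]
  exact ofDigits_mul_le_left b a

theorem ofDigits_add_le (a b : ℕ → Fin 2) :
    ofDigits a + ofDigits b ≤ 1 + ofDigits (a * b) := by
  have h1 : ofDigits (fun _ => (1 : Fin 2)) = 1 := Real.ofDigits_const_last_eq_one 1
  rw [← h1]
  simp only [ofDigits]
  rw [← Real.summable_ofDigitsTerm.tsum_add Real.summable_ofDigitsTerm,
    ← Real.summable_ofDigitsTerm.tsum_add Real.summable_ofDigitsTerm]
  refine Summable.tsum_mono (Real.summable_ofDigitsTerm.add Real.summable_ofDigitsTerm)
    (Real.summable_ofDigitsTerm.add Real.summable_ofDigitsTerm) fun n => ?_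
  have h : ∀ i j : Fin 2, (i : ℕ) + j ≤ ((1 : Fin 2) : ℕ) + ((i * j : Fin 2) : ℕ) := by decide
  simp only [Real.ofDigitsTerm, Pi.mul_apply, ← add_mul]
  exact mul_le_mul_of_nonneg_right (by exact_mod_cast h (a n) (b n)) (by positivity)

/-! ### The tile -/

/-- The eight digits of the tile. -/
noncomputable def digit (d : Fin 2 × Fin 2 × Fin 2) : E3 :=
  !₂[((d.1 : ℕ) : ℝ), ((d.2.1 : ℕ) : ℝ), 3 * ((d.1 : ℕ) * (d.2.1 : ℕ)) + ((d.2.2 : ℕ) : ℝ)]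

/-- The point of the tile with prescribed binary expansions of the first two coordinates, at
height `t` above the bottom of its fibre. -/
noncomputable def point (a b : ℕ → Fin 2) (t : ℝ) : E3 :=
  !₂[ofDigits a, ofDigits b, 3 * ofDigits (a * b) + t]

/-- The tile: a unit square bundle whose fibres are unit intervals, the fibre over `(x, y)` starting
at height `3 ∑ xₙ yₙ 2⁻ⁿ`, where `xₙ` and `yₙ` are the binary digits of `x` and `y`. -/
def tile : Set E3 := {q | ∃ a b : ℕ → Fin 2, ∃ t ∈ Icc (0 : ℝ) 1, point a b t = q}

/-- The contraction of the iterated function system of the tile belonging to a digit. -/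
noncomputable def contract (d : Fin 2 × Fin 2 × Fin 2) (q : E3) : E3 :=
  (2⁻¹ : ℝ) • (digit d + q)

@[simp] theorem contract_zero (d : Fin 2 × Fin 2 × Fin 2) (q : E3) :
    contract d q 0 = ((d.1 : ℕ) + q 0) / 2 := by
  simp [contract, digit]; ring

@[simp] theorem contract_one (d : Fin 2 × Fin 2 × Fin 2) (q : E3) :
    contract d q 1 = ((d.2.1 : ℕ) + q 1) / 2 := by
  simp [contract, digit]; ring

@[simp] theorem contract_two (d : Fin 2 × Fin 2 × Fin 2) (q : E3) :
    contract d q 2 = (3 * ((d.1 : ℕ) * (d.2.1 : ℕ)) + (d.2.2 : ℕ) + q 2) / 2 := by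
  simp [contract, digit]; ring

theorem ext_coords {p q : E3} (h0 : p 0 = q 0) (h1 : p 1 = q 1) (h2 : p 2 = q 2) : p = q := by
  ext i
  fin_cases i
  exacts [h0, h1, h2]

theorem vec_two (x y z : ℝ) : ![x, y, z] 2 = z := rfl

theorem contract_point (i j k : Fin 2) (a b : ℕ → Fin 2) (t : ℝ) (a' b' : ℕ → Fin 2)
    (ha0 : a' 0 = i) (hb0 : b' 0 = j) (ha : ∀ n, a' (n + 1) = a n) (hb : ∀ n, b' (n + 1) = b n) :
    contract (i, j, k) (point a b t) = point a' b' (((k : ℕ) + t) / 2) := by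
  have h1 := two_mul_ofDigits a'
  have h2 := two_mul_ofDigits b'
  have h3 := two_mul_ofDigits (a' * b')
  have hm : ∀ i j : Fin 2, ((i * j : Fin 2) : ℕ) = (i : ℕ) * j := by decide
  have hab : (fun n => (a' * b') (n + 1)) = a * b := by
    funext n
    simp [ha, hb]
  rw [hab] at h3
  simp only [ha, hb, ha0, hb0, Pi.mul_apply, hm] at h1 h2 h3
  push_cast at h3
  apply ext_coords
  · simp [point]
    linarith
  · simp [point]
    linarith
  · simp [point]
    linarith

theorem contract_mem_tile (d : Fin 2 × Fin 2 × Fin 2) {q : E3} (hq : q ∈ tile) :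
    contract d q ∈ tile := by
  obtain ⟨a, b, t, ⟨ht0, ht1⟩, rfl⟩ := hq
  obtain ⟨i, j, k⟩ := d
  refine ⟨fun n => n.casesOn i a, fun n => n.casesOn j b, ((k : ℕ) + t) / 2, ?_, ?_⟩
  · have hk : ((k : ℕ) : ℝ) ≤ 1 := by exact_mod_cast Nat.lt_succ_iff.mp k.2
    constructor
    · positivity
    · linarith
  · exact (contract_point i j k a b t _ _ rfl rfl (fun _ => rfl) fun _ => rfl).symm

theorem exists_contract_eq {q : E3} (hq : q ∈ tile) : ∃ d, ∃ p ∈ tile, contract d p = q := by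
  obtain ⟨a, b, t, ⟨ht0, ht1⟩, rfl⟩ := hq
  obtain ⟨k, hk0, hk1⟩ : ∃ k : Fin 2, 0 ≤ 2 * t - (k : ℕ) ∧ 2 * t - (k : ℕ) ≤ 1 := by
    rcases le_total t (1 / 2) with h | h
    · exact ⟨0, by simp; linarith, by simp; linarith⟩
    · exact ⟨1, by simp; linarith, by simp; linarith⟩
  refine ⟨(a 0, b 0, k), point (fun n => a (n + 1)) (fun n => b (n + 1)) (2 * t - (k : ℕ)),
    ⟨_, _, _, ⟨hk0, hk1⟩, rfl⟩, ?_⟩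
  rw [contract_point _ _ _ _ _ _ a b rfl rfl (fun _ => rfl) fun _ => rfl]
  congr 1
  ring

theorem two_smul_tile : (2 : ℝ) • tile = ⋃ d, (digit d + ·) '' tile := by
  ext q
  simp only [mem_iUnion, mem_image, mem_smul_set]
  constructor
  · rintro ⟨x, hx, rfl⟩
    obtain ⟨d, p, hp, rfl⟩ := exists_contract_eq hx
    exact ⟨d, p, hp, by simp [contract]⟩
  · rintro ⟨d, p, hp, rfl⟩
    exact ⟨contract d p, contract_mem_tile d hp, by simp [contract]⟩

theorem isCompact_tile : IsCompact tile := by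
  have h : tile = (fun p : (ℕ → Fin 2) × (ℕ → Fin 2) × ℝ => point p.1 p.2.1 p.2.2) ''
      (univ ×ˢ univ ×ˢ Icc 0 1) := by
    ext q
    constructor
    · rintro ⟨a, b, t, ht, rfl⟩
      exact ⟨(a, b, t), ⟨mem_univ _, mem_univ _, ht⟩, rfl⟩
    · rintro ⟨⟨a, b, t⟩, ⟨-, -, ht⟩, rfl⟩
      exact ⟨a, b, t, ht, rfl⟩
  rw [h]
  refine (isCompact_univ.prod (isCompact_univ.prod isCompact_Icc)).image ?_
  have hc : Continuous (ofDigits (b := 2)) := Real.continuous_ofDigits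
  have hmul : Continuous fun p : (ℕ → Fin 2) × (ℕ → Fin 2) × ℝ => p.1 * p.2.1 := by
    refine continuous_pi fun n => ?_
    have h1 : Continuous fun p : (ℕ → Fin 2) × (ℕ → Fin 2) × ℝ => (p.1 n, p.2.1 n) := by
      fun_prop
    exact (continuous_of_discreteTopology (f := fun x : Fin 2 × Fin 2 => x.1 * x.2)).comp h1
  refine (PiLp.continuous_toLp 2 _).comp (continuous_pi fun i => ?_)
  fin_cases i
  · exact hc.comp continuous_fst
  · exact hc.comp (continuous_fst.comp continuous_snd)
  · exact (continuous_const.mul (hc.comp hmul)).add (continuous_snd.comp continuous_snd)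

theorem bounds_of_mem_tile {q : E3} (hq : q ∈ tile) :
    0 ≤ q 0 ∧ q 0 ≤ 1 ∧ 0 ≤ q 1 ∧ q 1 ≤ 1 ∧ 0 ≤ q 2 ∧ q 2 ≤ 1 + 3 * q 1 := by
  obtain ⟨a, b, t, ⟨ht0, ht1⟩, rfl⟩ := hq
  have h1 := Real.ofDigits_nonneg a
  have h2 := Real.ofDigits_le_one a
  have h3 := Real.ofDigits_nonneg b
  have h4 := Real.ofDigits_le_one b
  have h5 := Real.ofDigits_nonneg (a * b)
  have h6 := ofDigits_mul_le_right a b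
  simp only [point]
  refine ⟨h1, h2, h3, h4, ?_, ?_⟩ <;> simp <;> linarith

/-! ### An open frame inside the tile -/

/-- An open set in the tile which surrounds the vertical line over the centre of the square. -/
def frame : Set E3 :=
  {q | 0 < q 0 ∧ q 0 < 1 ∧ 0 < q 1 ∧ q 1 < 1 ∧
    3 * min (q 0) (q 1) < q 2 ∧ q 2 < 1 + 3 * max 0 (q 0 + q 1 - 1)}

theorem isOpen_frame : IsOpen frame := by
  simp only [frame, ofPred_and]
  refine IsOpen.inter (isOpen_lt ?_ ?_) <| IsOpen.inter (isOpen_lt ?_ ?_) <|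
    IsOpen.inter (isOpen_lt ?_ ?_) <| IsOpen.inter (isOpen_lt ?_ ?_) <|
    IsOpen.inter (isOpen_lt ?_ ?_) (isOpen_lt ?_ ?_) <;> fun_prop

theorem frame_subset_tile : frame ⊆ tile := by
  rintro q ⟨hx0, hx1, hy0, hy1, hl, hu⟩
  obtain ⟨a, -, ha⟩ := Real.ofDigits_SurjOn (b := 2) one_lt_two ⟨hx0.le, hx1.le⟩
  obtain ⟨b, -, hb⟩ := Real.ofDigits_SurjOn (b := 2) one_lt_two ⟨hy0.le, hy1.le⟩
  have h1 : ofDigits (a * b) ≤ min (q 0) (q 1) :=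
    le_min (ha ▸ ofDigits_mul_le_left a b) (hb ▸ ofDigits_mul_le_right a b)
  have h2 : max 0 (q 0 + q 1 - 1) ≤ ofDigits (a * b) := by
    refine max_le (Real.ofDigits_nonneg _) ?_
    have := ofDigits_add_le a b
    linarith
  refine ⟨a, b, q 2 - 3 * ofDigits (a * b), ⟨by linarith, by linarith⟩, ?_⟩
  apply ext_coords <;> simp [point, ha, hb]

theorem frame_subset_interior : frame ⊆ interior tile :=
  interior_maximal frame_subset_tile isOpen_frame

theorem convex_setOf_lt (α β γ c : ℝ) :
    Convex ℝ {q : E3 | c < α * q 0 + β * q 1 + γ * q 2} :=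
  convex_halfSpace_gt ⟨fun p q => by simp; ring, fun r q => by simp; ring⟩ c

theorem mem_frame_iff {q : E3} :
    q ∈ frame ↔ 0 < q 0 ∧ q 0 < 1 ∧ 0 < q 1 ∧ q 1 < 1 ∧
      (3 * q 0 < q 2 ∨ 3 * q 1 < q 2) ∧ (q 2 < 1 ∨ q 2 < 3 * q 0 + 3 * q 1 - 2) := by
  have h1 : 3 * min (q 0) (q 1) = min (3 * q 0) (3 * q 1) :=
    mul_min_of_nonneg _ _ (by norm_num)
  have h2 : 1 + 3 * max 0 (q 0 + q 1 - 1) = max 1 (3 * q 0 + 3 * q 1 - 2) := by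
    rw [mul_max_of_nonneg _ _ (by norm_num), ← max_add_add_left]
    ring_nf
  simp only [frame, mem_ofPred_eq, h1, h2, min_lt_iff, lt_max_iff]

/-- One of the four convex pieces of the frame. -/
def framePiece (α β α' β' c : ℝ) : Set E3 :=
  {q | 0 < q 0 ∧ q 0 < 1 ∧ 0 < q 1 ∧ q 1 < 1 ∧
    α * q 0 + β * q 1 < q 2 ∧ q 2 < α' * q 0 + β' * q 1 + c}

theorem isPreconnected_framePiece (α β α' β' c : ℝ) :
    IsPreconnected (framePiece α β α' β' c) := by
  have h := (convex_setOf_lt 1 0 0 0).inter <| (convex_setOf_lt (-1) 0 0 (-1)).inter <|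
    (convex_setOf_lt 0 1 0 0).inter <| (convex_setOf_lt 0 (-1) 0 (-1)).inter <|
    (convex_setOf_lt (-α) (-β) 1 0).inter (convex_setOf_lt α' β' (-1) (-c))
  convert h.isPreconnected using 1
  ext q
  simp only [framePiece, mem_ofPred_eq, mem_inter_iff]
  constructor <;> rintro ⟨h1, h2, h3, h4, h5, h6⟩ <;>
    refine ⟨?_, ?_, ?_, ?_, ?_, ?_⟩ <;> linarith

theorem isPreconnected_frame : IsPreconnected frame := by
  have h : frame = framePiece 3 0 3 3 (-2) ∪ framePiece 3 0 0 0 1 ∪ framePiece 0 3 0 0 1 ∪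
      framePiece 0 3 3 3 (-2) := by
    ext q
    simp only [mem_frame_iff, framePiece, mem_union, mem_ofPred_eq, zero_mul, zero_add, add_zero,
      ← sub_eq_add_neg]
    tauto
  have hp := isPreconnected_framePiece
  rw [h]
  refine ((hp _ _ _ _ _).union !₂[1 / 10, 9 / 10, 1 / 2] ?_ ?_ (hp _ _ _ _ _)).union
    !₂[1 / 10, 1 / 10, 1 / 2] ?_ ?_ (hp _ _ _ _ _) |>.union
    !₂[9 / 10, 1 / 10, 1 / 2] ?_ ?_ (hp _ _ _ _ _) <;>
  norm_num [framePiece, vec_two]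

theorem exists_mem_frame_contract_mem_frame (d : Fin 2 × Fin 2 × Fin 2) :
    ∃ p ∈ frame, contract d p ∈ frame := by
  by_cases h : d.1 = 1 ∧ d.2.1 = 1
  · refine ⟨!₂[9 / 10, 9 / 10, 3], ?_, ?_⟩
    · norm_num [mem_frame_iff, vec_two]
    · obtain ⟨i, j, k⟩ := d
      obtain ⟨rfl, rfl⟩ := h
      fin_cases k <;> norm_num [mem_frame_iff, vec_two]
  · refine ⟨!₂[1 / 10, 1 / 10, 1 / 2], ?_, ?_⟩
    · norm_num [mem_frame_iff, vec_two]
    · obtain ⟨i, j, k⟩ := d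
      fin_cases i <;> fin_cases j <;> fin_cases k <;> revert h <;> norm_num [mem_frame_iff, vec_two]

/-! ### The interior is connected -/

theorem continuous_contract (d : Fin 2 × Fin 2 × Fin 2) : Continuous (contract d) := by
  unfold contract
  fun_prop

theorem contract_mem_interior (d : Fin 2 × Fin 2 × Fin 2) {q : E3} (hq : q ∈ interior tile) :
    contract d q ∈ interior tile := by
  have hopen : IsOpenMap (contract d) :=
    (isOpenMap_smul₀ (by norm_num : (2⁻¹ : ℝ) ≠ 0)).comp (isOpenMap_add_left (digit d))
  refine interior_maximal ?_ (hopen _ isOpen_interior) (mem_image_of_mem _ hq)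
  rintro _ ⟨p, hp, rfl⟩
  exact contract_mem_tile d (interior_subset hp)

theorem dist_contract (d : Fin 2 × Fin 2 × Fin 2) (p q : E3) :
    dist (contract d p) (contract d q) = 2⁻¹ * dist p q := by
  simp [contract, dist_smul₀]

theorem tile_subset_closure {S : Set E3} (hne : S.Nonempty)
    (hS : ∀ d, ∀ p ∈ S, contract d p ∈ S) : tile ⊆ closure S := by
  obtain ⟨s, hs⟩ := hne
  obtain ⟨M, hM⟩ := isCompact_tile.isBounded.subset_closedBall s
  have key : ∀ n : ℕ, ∀ q ∈ tile, Metric.infDist q S ≤ 2⁻¹ ^ n * M := by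
    intro n
    induction n with
    | zero =>
      intro q hq
      simpa using (Metric.infDist_le_dist_of_mem hs).trans (hM hq)
    | succ n ih =>
      intro q hq
      obtain ⟨d, p, hp, rfl⟩ := exists_contract_eq hq
      have h : 2 * Metric.infDist (contract d p) S ≤ Metric.infDist p S := by
        refine (Metric.le_infDist ⟨s, hs⟩).2 fun r hr => ?_
        have := Metric.infDist_le_dist_of_mem (x := contract d p) (hS d r hr)
        rw [dist_contract] at this
        linarith
      have := ih p hp
      rw [pow_succ]
      linarith
  intro q hq
  rw [Metric.mem_closure_iff_infDist_zero ⟨s, hs⟩]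
  have hlim : Filter.Tendsto (fun n : ℕ => (2⁻¹ : ℝ) ^ n * M) Filter.atTop (nhds 0) := by
    simpa using (tendsto_pow_atTop_nhds_zero_of_lt_one (r := (2⁻¹ : ℝ)) (by norm_num)
      (by norm_num)).mul_const M
  exact le_antisymm (ge_of_tendsto' hlim fun n => key n q hq) Metric.infDist_nonneg

theorem isConnected_interior_tile : IsConnected (interior tile) := by
  obtain ⟨b, hb, -⟩ := exists_mem_frame_contract_mem_frame (0, 0, 0)
  set S := connectedComponentIn (interior tile) b with hSdef
  have hbS : b ∈ S := mem_connectedComponentIn (frame_subset_interior hb)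
  have hfS : frame ⊆ S :=
    isPreconnected_frame.subset_connectedComponentIn hb frame_subset_interior
  have hSi : S ⊆ interior tile := connectedComponentIn_subset _ _
  have hS : ∀ d, ∀ p ∈ S, contract d p ∈ S := by
    intro d p hp
    obtain ⟨r, hr, hdr⟩ := exists_mem_frame_contract_mem_frame d
    have h := (isPreconnected_connectedComponentIn.image (contract d)
      (continuous_contract d).continuousOn).subset_connectedComponentIn (F := interior tile)
      (mem_image_of_mem _ (hfS hr)) (by
        rintro _ ⟨q, hq, rfl⟩
        exact contract_mem_interior d (hSi hq))
    rw [hSdef, connectedComponentIn_eq (hfS hdr)]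
    exact h (mem_image_of_mem _ hp)
  exact ⟨⟨b, hSi hbS⟩, isPreconnected_connectedComponentIn.subset_closure hSi
    (interior_subset.trans (tile_subset_closure ⟨b, hbS⟩ hS))⟩

/-! ### The interior is not simply connected -/

theorem le_of_mem_tile_of_half_lt {q : E3} (hq : q ∈ tile) (h0 : 1 / 2 < q 0) (h1 : 1 / 2 < q 1) :
    3 / 2 ≤ q 2 := by
  obtain ⟨⟨i, j, k⟩, p, hp, rfl⟩ := exists_contract_eq hq
  have hb := bounds_of_mem_tile hp
  have hk : (0 : ℝ) ≤ (k : ℕ) := by positivity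
  simp only [contract_zero, contract_one, contract_two] at h0 h1 ⊢
  fin_cases i <;> fin_cases j <;> simp at h0 h1 ⊢ <;> linarith

theorem le_of_mem_tile_of_lt_half {q : E3} (hq : q ∈ tile) (h0 : q 0 < 1 / 2) (h1 : 1 / 2 < q 1) :
    q 2 ≤ 1 + 3 * (q 1 - 1 / 2) := by
  obtain ⟨⟨i, j, k⟩, p, hp, rfl⟩ := exists_contract_eq hq
  have hb := bounds_of_mem_tile hp
  have hk : ((k : ℕ) : ℝ) ≤ 1 := by exact_mod_cast Nat.lt_succ_iff.mp k.2
  simp only [contract_zero, contract_one, contract_two] at h0 h1 ⊢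
  fin_cases i <;> fin_cases j <;> simp at h0 h1 ⊢ <;> linarith

theorem not_center_of_mem_interior {q : E3} (hq : q ∈ interior tile) :
    ¬ (q 0 = 1 / 2 ∧ q 1 = 1 / 2) := by
  rintro ⟨h0, h1⟩
  have key : ∀ σ : ℝ, ∀ᶠ δ in nhdsWithin (0 : ℝ) (Ioi 0),
      (!₂[1 / 2 + σ * δ, 1 / 2 + δ, q 2] : E3) ∈ tile := by
    intro σ
    have hc : Continuous fun δ : ℝ => (!₂[1 / 2 + σ * δ, 1 / 2 + δ, q 2] : E3) := by
      refine (PiLp.continuous_toLp 2 _).comp (continuous_pi fun i => ?_)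
      fin_cases i <;> simp <;> fun_prop
    refine nhdsWithin_le_nhds (hc.continuousAt.eventually_mem ?_)
    have : (!₂[1 / 2 + σ * 0, 1 / 2 + 0, q 2] : E3) = q := by
      apply ext_coords <;> simp [h0, h1]
    rw [this]
    exact mem_interior_iff_mem_nhds.1 hq
  obtain ⟨δ, ⟨hp, hm⟩, hδ0, hδ1⟩ := ((key 1).and (key (-1))).and
    (Ioo_mem_nhdsGT (by norm_num : (0 : ℝ) < 1 / 12)) |>.exists
  have e1 := le_of_mem_tile_of_half_lt hp (by simpa using hδ0) (by simpa using hδ0)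
  have e2 := le_of_mem_tile_of_lt_half hm (by simpa using hδ0) (by simpa using hδ0)
  simp at e1 e2
  linarith

/-- A loop in the frame around the vertical line over the centre of the square. -/
noncomputable def loop (t : ℝ) : E3 :=
  !₂[1 / 2 + Real.cos t / 4, 1 / 2 + Real.sin t / 4,
    (3 * min (1 / 2 + Real.cos t / 4) (1 / 2 + Real.sin t / 4) +
      (1 + 3 * max 0 (Real.cos t / 4 + Real.sin t / 4))) / 2]

theorem continuous_loop : Continuous loop := by
  refine (PiLp.continuous_toLp 2 _).comp (continuous_pi fun i => ?_)
  fin_cases i <;> simp <;> fun_prop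

theorem loop_mem_frame (t : ℝ) : loop t ∈ frame := by
  have h := Real.sin_sq_add_cos_sq t
  have hs1 := Real.sin_le_one t
  have hs2 := Real.neg_one_le_sin t
  have hc1 := Real.cos_le_one t
  have hc2 := Real.neg_one_le_cos t
  have hgap : 3 * min (1 / 2 + Real.cos t / 4) (1 / 2 + Real.sin t / 4) <
      1 + 3 * max 0 (Real.cos t / 4 + Real.sin t / 4) := by
    by_contra! hcon
    have m1 := min_le_left (1 / 2 + Real.cos t / 4) (1 / 2 + Real.sin t / 4)
    have m2 := min_le_right (1 / 2 + Real.cos t / 4) (1 / 2 + Real.sin t / 4)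
    have m3 := le_max_left 0 (Real.cos t / 4 + Real.sin t / 4)
    have m4 := le_max_right 0 (Real.cos t / 4 + Real.sin t / 4)
    have b1 : Real.cos t ≤ 2 / 3 := by linarith
    have b2 : -(2 / 3) ≤ Real.cos t := by linarith
    have b3 : Real.sin t ≤ 2 / 3 := by linarith
    have b4 : -(2 / 3) ≤ Real.sin t := by linarith
    nlinarith
  have e : 1 / 2 + Real.cos t / 4 + (1 / 2 + Real.sin t / 4) - 1 =
      Real.cos t / 4 + Real.sin t / 4 := by ring
  change 0 < 1 / 2 + Real.cos t / 4 ∧ 1 / 2 + Real.cos t / 4 < 1 ∧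
    0 < 1 / 2 + Real.sin t / 4 ∧ 1 / 2 + Real.sin t / 4 < 1 ∧
    3 * min (1 / 2 + Real.cos t / 4) (1 / 2 + Real.sin t / 4) < (_ + _) / 2 ∧
    (_ + _) / 2 < 1 + 3 * max 0 (1 / 2 + Real.cos t / 4 + (1 / 2 + Real.sin t / 4) - 1)
  rw [e]
  refine ⟨?_, ?_, ?_, ?_, ?_, ?_⟩ <;> linarith

theorem not_simplyConnectedSpace_interior_tile : ¬ SimplyConnectedSpace (interior tile) := by
  intro hsc
  let g : E3 → ℂ := fun q => ((q 0 - 1 / 2 : ℝ) : ℂ) + ((q 1 - 1 / 2 : ℝ) : ℂ) * Complex.I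
  have hg : Continuous g := by fun_prop
  have hg0 : 0 ∉ g '' interior tile := by
    rintro ⟨q, hq, hz⟩
    refine not_center_of_mem_interior hq ⟨?_, ?_⟩
    · have := congrArg Complex.re hz
      simp [g] at this
      linarith
    · have := congrArg Complex.im hz
      simp [g] at this
      linarith
  obtain ⟨f, hf, hfg⟩ := Complex.exists_continuousOn_eqOn_exp_comp
    (show IsSimplyConnected (interior tile) from hsc) isOpen_interior hg.continuousOn hg0
  have hmem : ∀ t, loop t ∈ interior tile := fun t => frame_subset_interior (loop_mem_frame t)
  have hcont : Continuous fun t : ℝ => f (loop t) - t * Complex.I := by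
    have := hf.comp_continuous continuous_loop hmem
    exact this.sub (by fun_prop)
  have hexp : ∀ t : ℝ, Complex.exp (f (loop t) - t * Complex.I) = 1 / 4 := by
    intro t
    have h1 : Complex.exp (f (loop t)) = 1 / 4 * Complex.exp (t * Complex.I) := by
      rw [show Complex.exp (f (loop t)) = g (loop t) from hfg (hmem t), Complex.exp_mul_I]
      simp [g, loop]
      ring
    rw [Complex.exp_sub, h1, mul_div_cancel_right₀ _ (Complex.exp_ne_zero _)]
  have hconst := Complex.isCoveringMap_exp.const_of_comp hcont
    (fun t t' => Subtype.ext (by simp only [hexp])) 0 (2 * Real.pi)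
  have hloop : loop (2 * Real.pi) = loop 0 := by simp [loop]
  rw [hloop] at hconst
  have := congrArg Complex.im hconst
  simp at this
  linarith [Real.pi_pos]

/-! ### Volume forces disjoint interiors -/

open MeasureTheory in
theorem disjoint_interior_of_smul_eq_iUnion {A : Set E3} (hA : IsCompact A)
    {h : Fin 8 → (E3 ≃ᵢ E3)} (hU : (2 : ℝ) • A = ⋃ i, h i '' A) :
    Pairwise fun i j => Disjoint (interior (h i '' A)) (interior (h j '' A)) := by
  intro i j hij
  by_contra hd
  obtain ⟨x, hxi, hxj⟩ := not_disjoint_iff.1 hd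
  set O := interior (h i '' A) ∩ interior (h j '' A)
  have hOo : IsOpen O := isOpen_interior.inter isOpen_interior
  have hOpos : 0 < volume O := hOo.measure_pos _ ⟨x, hxi, hxj⟩
  have hvol : ∀ k, volume (h k '' A) = volume A := fun k => by
    rw [← EuclideanSpace.euclideanHausdorffMeasure_eq_volume 3]
    exact (h k).isometry.euclideanHausdorffMeasure_image A
  have hfin : volume A ≠ ⊤ := hA.measure_lt_top.ne
  have h8 : volume ((2 : ℝ) • A) = 8 * volume A := by
    rw [Measure.addHaar_smul]
    norm_num
  have hsub : (2 : ℝ) • A ⊆ (⋃ k ∈ Finset.univ.erase i, h k '' A) ∪ (h i '' A \ O) := by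
    rw [hU]
    refine iUnion_subset fun k y hy => ?_
    by_cases hk : k = i
    · subst hk
      by_cases hyO : y ∈ O
      · exact Or.inl (mem_biUnion (Finset.mem_coe.2 (by simpa using hij.symm))
          (interior_subset hyO.2))
      · exact Or.inr ⟨hy, hyO⟩
    · exact Or.inl (mem_biUnion (Finset.mem_coe.2 (by simpa using hk)) hy)
  have hOsub : O ⊆ h i '' A := inter_subset_left.trans interior_subset
  have hOfin : volume O ≠ ⊤ := ne_top_of_le_ne_top (hvol i ▸ hfin) (measure_mono hOsub)
  have hdiff : volume (h i '' A \ O) + volume O = volume A := by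
    rw [measure_sdiff hOsub hOo.nullMeasurableSet hOfin, hvol,
      tsub_add_cancel_of_le (hvol i ▸ measure_mono hOsub)]
  have h7 : volume (⋃ k ∈ Finset.univ.erase i, h k '' A) ≤ 7 * volume A := by
    refine (measure_biUnion_finset_le _ _).trans ?_
    simp [hvol, Finset.card_erase_of_mem]
  have hle : 8 * volume A ≤ 7 * volume A + volume (h i '' A \ O) :=
    h8 ▸ (measure_mono hsub).trans ((measure_union_le _ _).trans (add_le_add_left h7 _))
  have hle' : 8 * volume A + volume O ≤ 8 * volume A := by
    calc 8 * volume A + volume O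
        ≤ 7 * volume A + volume (h i '' A \ O) + volume O := by gcongr
      _ = 8 * volume A := by
        rw [add_assoc, hdiff]
        ring
  have hA8 : 8 * volume A ≠ ⊤ := ENNReal.mul_ne_top (by norm_num) hfin
  exact (ENNReal.lt_add_right hA8 hOpos.ne').not_ge hle'

end RepTile

open RepTile in
/-- There exists a compact set `A` in ℝ³ with nonempty interior whose interior is
connected but not simply connected (so `A` has a hole), and which is an 8-rep-tile:
there are isometries `h 1, …, h 8` of ℝ³ with `2 • A = ⋃ i, h i '' A`, the interiors
of the pieces being pairwise disjoint. -/
theorem exists_rep_tile_with_hole :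
    ∃ A : Set (EuclideanSpace ℝ (Fin 3)),
      IsCompact A ∧ (interior A).Nonempty ∧
      IsConnected (interior A) ∧ ¬ SimplyConnectedSpace (interior A) ∧
      ∃ h : Fin 8 → (EuclideanSpace ℝ (Fin 3) ≃ᵢ EuclideanSpace ℝ (Fin 3)),
        (2 : ℝ) • A = ⋃ i, h i '' A ∧
        Pairwise fun i j => Disjoint (interior (h i '' A)) (interior (h j '' A)) := by
  let e : Fin 8 ≃ Fin 2 × Fin 2 × Fin 2 := Fintype.equivOfCardEq (by simp)
  have hU : (2 : ℝ) • tile = ⋃ i, IsometryEquiv.addLeft (digit (e i)) '' tile := by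
    rw [two_smul_tile]
    exact (e.surjective.iUnion_comp fun d => (digit d + ·) '' tile).symm
  exact ⟨tile, isCompact_tile, isConnected_interior_tile.nonempty, isConnected_interior_tile,
    not_simplyConnectedSpace_interior_tile, _, hU,
    disjoint_interior_of_smul_eq_iUnion isCompact_tile hU⟩
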